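/- arXiv:2005.10660 — 2 statements merged into one kernel-verified Lean document; each statement's English description precedes it below -/
import Mathlib

section
/- Let u* ∈ U be a minimizer over U of u ↦ sup_{π∈Π} F(θ, z, π, u), and set π* := Proj_Π((θ + z + u*)/(1 − δ)). Then (π*, u*) is a saddle point of F(θ,z,·,·) on Π × U, i.e. F(θ, z, π, u*) ≤ F(θ, z, π*, u*) ≤ F(θ, z, π*, u) for all π ∈ Π and u ∈ U; consequently the minimax equality holds: inf_{u∈U} sup_{π∈Π} F(θ, z, π, u) = sup_{π∈Π} inf_{u∈U} F(θ, z, π, u) = F(θ, z, π*, u*). -/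
open RealInnerProductSpace

/-- The Hamiltonian `F(θ, z, π, u)`. -/
noncomputable def F {d : ℕ} (δ : ℝ) (θ z p u : EuclideanSpace ℝ (Fin d)) : ℝ :=
  -(1/2) * δ * (1 - δ) * ‖p‖^2 + δ * ⟪p, θ + z + u⟫ + ⟪z, u⟫ + (1/2) * ‖z‖^2

/-- A nearest-point map onto a convex set satisfies the obtuse-angle inequality. -/
lemma inner_sub_nearest_le_zero {E : Type*} [NormedAddCommGroup E] [InnerProductSpace ℝ E]
    {K : Set E} (hK : Convex ℝ K) {x q : E} (hq : q ∈ K) (hmin : ∀ y ∈ K, ‖x - q‖ ≤ ‖x - y‖) :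
    ∀ y ∈ K, ⟪x - q, y - q⟫ ≤ 0 := by
  rw [← norm_eq_iInf_iff_real_inner_le_zero hK hq]
  have : Nonempty K := ⟨⟨q, hq⟩⟩
  refine le_antisymm (le_ciInf fun y => hmin y y.2) ?_
  exact ciInf_le (f := fun y : K => ‖x - y‖)
    ⟨0, by rintro _ ⟨y, rfl⟩; exact norm_nonneg _⟩ ⟨q, hq⟩

/-- A nearest-point map onto a convex set is nonexpansive. -/
lemma lipschitzWith_one_nearest {E : Type*} [NormedAddCommGroup E] [InnerProductSpace ℝ E]
    {K : Set E} (hK : Convex ℝ K) {f : E → E}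
    (hf : ∀ x, f x ∈ K ∧ ∀ y ∈ K, ‖x - f x‖ ≤ ‖x - y‖) : LipschitzWith 1 f := by
  refine LipschitzWith.of_dist_le_mul fun x y => ?_
  rw [dist_eq_norm, dist_eq_norm, NNReal.coe_one, one_mul]
  have h1 := inner_sub_nearest_le_zero hK (hf x).1 (hf x).2 (f y) (hf y).1
  have h2 := inner_sub_nearest_le_zero hK (hf y).1 (hf y).2 (f x) (hf x).1
  have h3 : ⟪x - f x, f y - f x⟫ + ⟪y - f y, f x - f y⟫
      = ‖f x - f y‖ ^ 2 - ⟪x - y, f x - f y⟫ := by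
    rw [← real_inner_self_eq_norm_sq, ← neg_sub (f x) (f y), inner_neg_right]
    simp only [inner_sub_left]
    ring
  have h4 := real_inner_le_norm (x - y) (f x - f y)
  by_contra! hlt
  nlinarith [norm_nonneg (x - y), norm_nonneg (f x - f y)]

/-- Completing the square in `p`. -/
lemma F_eq_sub_norm_sq {d : ℕ} {δ : ℝ} (hδ : δ < 1) (θ z p u : EuclideanSpace ℝ (Fin d)) :
    F δ θ z p u = -(δ * (1 - δ) / 2) * ‖(1 - δ)⁻¹ • (θ + z + u) - p‖ ^ 2
      + (δ * (1 - δ) / 2 * ‖(1 - δ)⁻¹ • (θ + z + u)‖ ^ 2 + ⟪z, u⟫ + (1/2) * ‖z‖ ^ 2) := by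
  have h : (1 - δ) ≠ 0 := by linarith
  rw [norm_sub_sq_real, real_inner_smul_left, real_inner_comm, F]
  field_simp
  ring

/-- The maximizer of `F` in `p` is the nearest point to `(θ + z + u) / (1 - δ)`. -/
lemma F_le_F_nearest {d : ℕ} {δ : ℝ} (hδ : δ ∈ Set.Ioo (0 : ℝ) 1)
    {θ z p q u : EuclideanSpace ℝ (Fin d)}
    (hq : ‖(1 - δ)⁻¹ • (θ + z + u) - q‖ ≤ ‖(1 - δ)⁻¹ • (θ + z + u) - p‖) :
    F δ θ z p u ≤ F δ θ z q u := by
  rw [F_eq_sub_norm_sq hδ.2, F_eq_sub_norm_sq hδ.2]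
  have h : 0 ≤ δ * (1 - δ) / 2 := by nlinarith [hδ.1, hδ.2]
  have := mul_le_mul_of_nonneg_left (pow_le_pow_left₀ (norm_nonneg _) hq 2) h
  linarith

/-- `F` is affine in `u`. -/
lemma F_add_smul {d : ℕ} (δ : ℝ) (θ z p u w : EuclideanSpace ℝ (Fin d)) (t : ℝ) :
    F δ θ z p (u + t • w) = F δ θ z p u + t * (δ * ⟪p, w⟫ + ⟪z, w⟫) := by
  simp only [F, inner_add_right, real_inner_smul_right]
  ring

/-- `(π*, u*)` with `u*` a minimizer of `u ↦ sup_{π∈Π} F(θ,z,π,u)` and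
`π* = Proj_Π((θ+z+u*)/(1-δ))` is a saddle point of `F(θ,z,·,·)` on `Π × U`, and the
minimax equality holds. -/
theorem stmt_2 {d : ℕ} (hd : 1 ≤ d) {δ : ℝ} (hδ : δ ∈ Set.Ioo (0:ℝ) 1)
    (P U : Set (EuclideanSpace ℝ (Fin d)))
    (hPne : P.Nonempty) (hPcl : IsClosed P) (hPconv : Convex ℝ P)
    (hP0 : (0 : EuclideanSpace ℝ (Fin d)) ∈ P)
    (hUne : U.Nonempty) (hUcomp : IsCompact U) (hUconv : Convex ℝ U)
    (projP : EuclideanSpace ℝ (Fin d) → EuclideanSpace ℝ (Fin d))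
    (hprojP : ∀ x, projP x ∈ P ∧ ∀ y ∈ P, ‖x - projP x‖ ≤ ‖x - y‖)
    (θ z : EuclideanSpace ℝ (Fin d))
    (ustar : EuclideanSpace ℝ (Fin d)) (hustarU : ustar ∈ U)
    (hustar : ∀ u ∈ U, sSup ((fun p => F δ θ z p ustar) '' P) ≤
      sSup ((fun p => F δ θ z p u) '' P)) :
    (∀ p ∈ P, F δ θ z p ustar ≤ F δ θ z (projP ((1 - δ)⁻¹ • (θ + z + ustar))) ustar) ∧
    (∀ u ∈ U, F δ θ z (projP ((1 - δ)⁻¹ • (θ + z + ustar))) ustar ≤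
      F δ θ z (projP ((1 - δ)⁻¹ • (θ + z + ustar))) u) ∧
    sInf ((fun u => sSup ((fun p => F δ θ z p u) '' P)) '' U) =
      F δ θ z (projP ((1 - δ)⁻¹ • (θ + z + ustar))) ustar ∧
    sSup ((fun p => sInf ((fun u => F δ θ z p u) '' U)) '' P) =
      F δ θ z (projP ((1 - δ)⁻¹ • (θ + z + ustar))) ustar := by
  have hmax : ∀ u, IsGreatest ((fun p => F δ θ z p u) '' P)
      (F δ θ z (projP ((1 - δ)⁻¹ • (θ + z + u))) u) := by
    intro u
    refine ⟨⟨_, (hprojP _).1, rfl⟩, ?_⟩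
    rintro _ ⟨p, hp, rfl⟩
    exact F_le_F_nearest hδ ((hprojP _).2 p hp)
  have hleft : ∀ p ∈ P,
      F δ θ z p ustar ≤ F δ θ z (projP ((1 - δ)⁻¹ • (θ + z + ustar))) ustar :=
    fun p hp => (hmax ustar).2 ⟨p, hp, rfl⟩
  have hright : ∀ u ∈ U, F δ θ z (projP ((1 - δ)⁻¹ • (θ + z + ustar))) ustar ≤
      F δ θ z (projP ((1 - δ)⁻¹ • (θ + z + ustar))) u := by
    intro u hu
    let g : ℝ → ℝ := fun t =>
      δ * ⟪projP ((1 - δ)⁻¹ • (θ + z + (ustar + t • (u - ustar)))), u - ustar⟫ + ⟪z, u - ustar⟫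
    have hg : Continuous g := by
      have := (lipschitzWith_one_nearest hPconv hprojP).continuous
      fun_prop
    have hpos : ∀ᶠ t in nhdsWithin (0 : ℝ) (Set.Ioi 0), 0 ≤ g t := by
      filter_upwards [Ioc_mem_nhdsGT (zero_lt_one' ℝ)] with t ht
      have hmem : ustar + t • (u - ustar) ∈ U :=
        hUconv.add_smul_sub_mem hustarU hu ⟨ht.1.le, ht.2⟩
      have h1 := hustar _ hmem
      rw [(hmax _).csSup_eq, (hmax _).csSup_eq, F_add_smul] at h1
      have h2 := hleft _ (hprojP ((1 - δ)⁻¹ • (θ + z + (ustar + t • (u - ustar))))).1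
      exact nonneg_of_mul_nonneg_right (by linarith) ht.1
    have h0 : 0 ≤ g 0 := ge_of_tendsto (hg.continuousAt.mono_left nhdsWithin_le_nhds) hpos
    have h1 := F_add_smul δ θ z (projP ((1 - δ)⁻¹ • (θ + z + ustar))) ustar (u - ustar) 1
    simp only [one_smul, add_sub_cancel, one_mul] at h1
    simp only [g, zero_smul, add_zero] at h0
    linarith
  refine ⟨hleft, hright, ?_, ?_⟩
  · refine IsLeast.csInf_eq ⟨⟨ustar, hustarU, (hmax ustar).csSup_eq⟩, ?_⟩
    rintro _ ⟨u, hu, rfl⟩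
    exact (hmax ustar).csSup_eq ▸ hustar u hu
  · refine IsGreatest.csSup_eq ⟨⟨_, (hprojP _).1, IsLeast.csInf_eq
      ⟨⟨ustar, hustarU, rfl⟩, by rintro _ ⟨u, hu, rfl⟩; exact hright u hu⟩⟩, ?_⟩
    rintro _ ⟨p, hp, rfl⟩
    have hcont : Continuous fun u => F δ θ z p u := by
      unfold F
      fun_prop
    exact (csInf_le (hUcomp.image hcont).bddBelow ⟨ustar, hustarU, rfl⟩).trans (hleft p hp)
end

section
/- For all real θ, z₁, z₂, the infimum over U_R of (u₁,u₂) ↦ sup_{π₁∈ℝ} F₂(θ, z₁, z₂, π₁, u₁, u₂) is attained at u₁* = Proj_{[−R,R]}(−θ − z₁/δ − ((1−δ)/δ)z₂·1_{z₂≥0}) and u₂* = u₁* if z₂ ≥ 0, u₂* = R if z₂ < 0; moreover, for every fixed (u₁,u₂) ∈ U_R, the supremum over π₁ ∈ ℝ is attained at π₁ = (θ + z₁ + u₁)/(1 − δ). -/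
/-- The Hamiltonian `F₂(θ, z₁, z₂, π₁, u₁, u₂)` for the single stock, single stochastic
factor model. -/
noncomputable def F2 (δ θ z1 z2 p1 u1 u2 : ℝ) : ℝ :=
  -(1/2) * δ * (1 - δ) * p1^2 + δ * p1 * (θ + z1 + u1) + z1 * u1 + z2 * u2
    + (1/2) * (z1^2 + z2^2)

theorem F2_eq_sub_sq {δ : ℝ} (hδ : δ < 1) (θ z1 z2 p1 u1 u2 : ℝ) :
    F2 δ θ z1 z2 p1 u1 u2 = F2 δ θ z1 z2 ((θ + z1 + u1) / (1 - δ)) u1 u2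
      - δ * (1 - δ) / 2 * (p1 - (θ + z1 + u1) / (1 - δ)) ^ 2 := by
  have h : 1 - δ ≠ 0 := by linarith
  unfold F2
  field_simp
  ring

theorem F2_le_F2_argmax {δ : ℝ} (hδ : δ ∈ Set.Ioo (0 : ℝ) 1) (θ z1 z2 p1 u1 u2 : ℝ) :
    F2 δ θ z1 z2 p1 u1 u2 ≤ F2 δ θ z1 z2 ((θ + z1 + u1) / (1 - δ)) u1 u2 := by
  have h : 0 < 1 - δ := by linarith [hδ.2]
  have h0 : 0 < δ := hδ.1
  rw [F2_eq_sub_sq hδ.2 θ z1 z2 p1]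
  have : 0 ≤ δ * (1 - δ) / 2 * (p1 - (θ + z1 + u1) / (1 - δ)) ^ 2 := by positivity
  linarith

theorem iSup_F2 {δ : ℝ} (hδ : δ ∈ Set.Ioo (0 : ℝ) 1) (θ z1 z2 u1 u2 : ℝ) :
    ⨆ p1 : ℝ, F2 δ θ z1 z2 p1 u1 u2 =
      δ / (2 * (1 - δ)) * (θ + z1 + u1) ^ 2 + z1 * u1 + z2 * u2 + (1/2) * (z1^2 + z2^2) := by
  have h : 1 - δ ≠ 0 := by linarith [hδ.2]
  have hmax : IsGreatest (Set.range fun p1 : ℝ => F2 δ θ z1 z2 p1 u1 u2)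
      (F2 δ θ z1 z2 ((θ + z1 + u1) / (1 - δ)) u1 u2) :=
    ⟨⟨_, rfl⟩, by rintro _ ⟨p1, rfl⟩; exact F2_le_F2_argmax hδ ..⟩
  rw [iSup, hmax.csSup_eq]
  unfold F2
  field_simp
  ring

theorem sq_clamp_sub_le {a b m q : ℝ} (ha : a ≤ q) (hb : q ≤ b) :
    (max a (min b m) - m) ^ 2 ≤ (q - m) ^ 2 := by
  rcases le_total b m with h | h
  · rw [min_eq_left h, max_eq_right (ha.trans hb)]
    nlinarith
  · rw [min_eq_right h]
    rcases le_total a m with h' | h'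
    · rw [max_eq_right h']
      nlinarith [sq_nonneg (q - m)]
    · rw [max_eq_left h']
      nlinarith

/-- A convex quadratic is minimized on an interval at the projection of its vertex. -/
theorem quadratic_clamp_le {c A B a b m q : ℝ} (hc : 0 ≤ c) (hm : 2 * c * (A + m) + B = 0)
    (ha : a ≤ q) (hb : q ≤ b) :
    c * (A + max a (min b m)) ^ 2 + B * max a (min b m) ≤ c * (A + q) ^ 2 + B * q := by
  have h := mul_le_mul_of_nonneg_left (sq_clamp_sub_le (m := m) ha hb) hc
  obtain rfl : B = -(2 * c * (A + m)) := by linarith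
  linarith

/-- the infimum over the triangle `U_R` of
`(u₁,u₂) ↦ sup_{π₁∈ℝ} F₂(θ,z₁,z₂,π₁,u₁,u₂)` is attained at
`u₁* = Proj_{[-R,R]}(-θ - z₁/δ - ((1-δ)/δ)z₂·1_{z₂≥0})`, `u₂* = u₁*` if `z₂ ≥ 0` and
`u₂* = R` if `z₂ < 0`; moreover for each fixed `(u₁,u₂) ∈ U_R` the supremum over
`π₁ ∈ ℝ` is attained at `π₁ = (θ + z₁ + u₁)/(1-δ)`. -/
theorem stmt_12 {δ R : ℝ} (hδ : δ ∈ Set.Ioo (0:ℝ) 1) (hR : 0 < R)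
    (θ z1 z2 : ℝ) :
    (max (-R) (min R (-θ - z1 / δ - ((1 - δ) / δ) * z2 * (if 0 ≤ z2 then (1:ℝ) else 0))),
      if 0 ≤ z2 then
        max (-R) (min R (-θ - z1 / δ - ((1 - δ) / δ) * z2 * (if 0 ≤ z2 then (1:ℝ) else 0)))
      else R) ∈ {q : ℝ × ℝ | -R ≤ q.1 ∧ q.1 ≤ q.2 ∧ q.2 ≤ R} ∧
    IsMinOn (fun q : ℝ × ℝ => ⨆ p1 : ℝ, F2 δ θ z1 z2 p1 q.1 q.2)
      {q : ℝ × ℝ | -R ≤ q.1 ∧ q.1 ≤ q.2 ∧ q.2 ≤ R}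
      (max (-R) (min R (-θ - z1 / δ - ((1 - δ) / δ) * z2 * (if 0 ≤ z2 then (1:ℝ) else 0))),
        if 0 ≤ z2 then
          max (-R) (min R (-θ - z1 / δ - ((1 - δ) / δ) * z2 * (if 0 ≤ z2 then (1:ℝ) else 0)))
        else R) ∧
    (∀ u1 u2 : ℝ, (u1, u2) ∈ {q : ℝ × ℝ | -R ≤ q.1 ∧ q.1 ≤ q.2 ∧ q.2 ≤ R} →
      IsMaxOn (fun p1 : ℝ => F2 δ θ z1 z2 p1 u1 u2) Set.univ ((θ + z1 + u1) / (1 - δ))) := by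
  have h0 : 0 < δ := hδ.1
  have h1 : 0 < 1 - δ := by linarith [hδ.2]
  have hc : 0 ≤ δ / (2 * (1 - δ)) := by positivity
  refine ⟨?_, ?_, fun u1 u2 _ p1 _ => F2_le_F2_argmax hδ ..⟩
  · refine ⟨le_max_left _ _, ?_, ?_⟩ <;> split_ifs <;> simp [hR.le]
  · rintro ⟨q1, q2⟩ ⟨hq1, hq12, hq2⟩
    simp only [Set.mem_ofPred_eq, iSup_F2 hδ] at hq1 hq12 hq2 ⊢
    split_ifs with hz
    · have hm : 2 * (δ / (2 * (1 - δ))) * (θ + z1 + (-θ - z1 / δ - (1 - δ) / δ * z2 * 1))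
          + (z1 + z2) = 0 := by
        field_simp
        ring
      have key := quadratic_clamp_le hc hm hq1 (hq12.trans hq2)
      have := mul_le_mul_of_nonneg_left hq12 hz
      linarith
    · have hm : 2 * (δ / (2 * (1 - δ))) * (θ + z1 + (-θ - z1 / δ - (1 - δ) / δ * z2 * 0))
          + z1 = 0 := by
        field_simp
        ring
      have key := quadratic_clamp_le hc hm hq1 (hq12.trans hq2)
      have := mul_le_mul_of_nonpos_left hq2 (not_le.mp hz).le
      linarith
end
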